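/- Let G be a finite group and ((A^(i), G, α^(i)), φ_i)_{i∈ℕ} an inductive sequence of partial dynamical systems in which every A^(i) is a unital C*-algebra and every φ_i is a unital *-homomorphism. Let (A, (μ_i)) be a concrete inductive limit of (A^(i), φ_i) with each μ_i unital (so A is unital), and let α be the inductive limit partial action of G on A. If k ∈ ℕ and there are infinitely many i ∈ ℕ such that α^(i) has Rokhlin dimension at most k, then α has Rokhlin dimension at most k. In particular, dim_Rok(α) ≤ liminf_{i→∞} dim_Rok(α^(i)). -/

import Mathlib

open scoped ComplexOrder

/-- A partial action of a discrete group `G` on a C*-algebra `A`, encoded elementwise: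
`I g` is the closed two-sided ideal `A_g`, and `θ g : A → A` is a (total extension of the)
*-isomorphism `α_g : A_{g⁻¹} → A_g`; all axioms are only imposed on the relevant ideals. -/
structure CStarPartialAction (G : Type*) [Group G] (A : Type*)
    [NonUnitalNormedRing A] [StarRing A] [Module ℂ A] where
  I : G → Set A
  isClosed : ∀ g, IsClosed (I g)
  zero_mem : ∀ g, (0 : A) ∈ I g
  add_mem : ∀ g, ∀ a ∈ I g, ∀ b ∈ I g, a + b ∈ I g
  smul_mem : ∀ g (c : ℂ), ∀ a ∈ I g, c • a ∈ I g
  mul_mem_left : ∀ g (x : A), ∀ a ∈ I g, x * a ∈ I g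
  mul_mem_right : ∀ g (x : A), ∀ a ∈ I g, a * x ∈ I g
  star_mem : ∀ g, ∀ a ∈ I g, star a ∈ I g
  θ : G → A → A
  mapsTo : ∀ g, ∀ a ∈ I g⁻¹, θ g a ∈ I g
  θ_add : ∀ g, ∀ a ∈ I g⁻¹, ∀ b ∈ I g⁻¹, θ g (a + b) = θ g a + θ g b
  θ_smul : ∀ g (c : ℂ), ∀ a ∈ I g⁻¹, θ g (c • a) = c • θ g a
  θ_mul : ∀ g, ∀ a ∈ I g⁻¹, ∀ b ∈ I g⁻¹, θ g (a * b) = θ g a * θ g b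
  θ_star : ∀ g, ∀ a ∈ I g⁻¹, θ g (star a) = star (θ g a)
  θ_surjOn : ∀ g, ∀ b ∈ I g, ∃ a ∈ I g⁻¹, θ g a = b
  θ_injOn : ∀ g, ∀ a ∈ I g⁻¹, ∀ b ∈ I g⁻¹, θ g a = θ g b → a = b
  I_one : I 1 = Set.univ
  θ_one : ∀ a : A, θ 1 a = a
  mem_comp : ∀ g h, ∀ x ∈ I h⁻¹, θ h x ∈ I g⁻¹ → x ∈ I (g * h)⁻¹
  θ_comp : ∀ g h, ∀ x ∈ I h⁻¹, θ h x ∈ I g⁻¹ → θ g (θ h x) = θ (g * h) x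

/-- A map `φ : A → B` is `G`-equivariant with respect to partial actions `α` on `A` and
`β` on `B` if `φ(A_g) ⊆ B_g` and `φ ∘ α_g = β_g ∘ φ` on `A_{g⁻¹}`. -/
def IsEquivariantMap {G : Type*} [Group G] {A B : Type*}
    [NonUnitalNormedRing A] [StarRing A] [Module ℂ A]
    [NonUnitalNormedRing B] [StarRing B] [Module ℂ B]
    (α : CStarPartialAction G A) (β : CStarPartialAction G B) (φ : A → B) : Prop :=
  (∀ g, φ '' α.I g ⊆ β.I g) ∧ ∀ g, ∀ a ∈ α.I g⁻¹, φ (α.θ g a) = β.θ g (φ a)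

/-- The composite `φ_{i,i+j} = φ_{i+j-1} ∘ ⋯ ∘ φ_i : A_i → A_{i+j}` of the connecting maps
of an inductive sequence. -/
def iterMap {A : ℕ → Type*} (φ : ∀ i, A i → A (i + 1)) (i : ℕ) : (j : ℕ) → A i → A (i + j)
  | 0 => id
  | j + 1 => fun a => φ (i + j) (iterMap φ i j a)

/-- A partial action `α` of a finite group `G` on a unital C*-algebra `A` has Rokhlin
dimension at most `k`: for every `ε > 0` and finite `F ⊆ A` there are positive contractions
`f j g ∈ A_g` (`j = 0, …, k`, `g ∈ G`) satisfying the four Rokhlin tower conditions. -/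
def HasRokhlinDimLE {G : Type*} [Group G] [Fintype G] {A : Type*}
    [NormedRing A] [StarRing A] [Module ℂ A] [PartialOrder A]
    (α : CStarPartialAction G A) (k : ℕ) : Prop :=
  ∀ ε : ℝ, 0 < ε → ∀ F : Finset A, ∃ f : Fin (k + 1) → G → A,
    (∀ (j : Fin (k + 1)) (g : G), f j g ∈ α.I g ∧ 0 ≤ f j g ∧ ‖f j g‖ ≤ 1) ∧
    (∀ (g h : G) (j : Fin (k + 1)), ∀ x ∈ F, x ∈ α.I g⁻¹ →
      ‖α.θ g (f j h * x) - f j (g * h) * α.θ g x‖ < ε) ∧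
    (∀ (j : Fin (k + 1)) (g h : G), g ≠ h → ‖f j g * f j h‖ < ε) ∧
    ‖(∑ j : Fin (k + 1), ∑ g : G, f j g) - 1‖ < ε ∧
    (∀ (j : Fin (k + 1)) (g : G), ∀ a ∈ F, ‖f j g * a - a * f j g‖ < ε)

/-- Rokhlin dimension with commuting towers at most `k`: in addition, the towers can be
chosen to approximately commute with each other. -/
def HasRokhlinDimWithCommutingTowersLE {G : Type*} [Group G] [Fintype G] {A : Type*}
    [NormedRing A] [StarRing A] [Module ℂ A] [PartialOrder A]
    (α : CStarPartialAction G A) (k : ℕ) : Prop :=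
  ∀ ε : ℝ, 0 < ε → ∀ F : Finset A, ∃ f : Fin (k + 1) → G → A,
    (∀ (j : Fin (k + 1)) (g : G), f j g ∈ α.I g ∧ 0 ≤ f j g ∧ ‖f j g‖ ≤ 1) ∧
    (∀ (g h : G) (j : Fin (k + 1)), ∀ x ∈ F, x ∈ α.I g⁻¹ →
      ‖α.θ g (f j h * x) - f j (g * h) * α.θ g x‖ < ε) ∧
    (∀ (j : Fin (k + 1)) (g h : G), g ≠ h → ‖f j g * f j h‖ < ε) ∧
    ‖(∑ j : Fin (k + 1), ∑ g : G, f j g) - 1‖ < ε ∧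
    (∀ (j : Fin (k + 1)) (g : G), ∀ a ∈ F, ‖f j g * a - a * f j g‖ < ε) ∧
    (∀ (j l : Fin (k + 1)) (g h : G), ‖f j g * f l h - f l h * f j g‖ < ε)

/-- The closed two-sided ideal `A_g` as a non-unital star subalgebra. -/
def CStarPartialAction.ideal {G : Type*} [Group G] {B : Type*} [CStarAlgebra B]
    (α : CStarPartialAction G B) (g : G) : NonUnitalStarSubalgebra ℂ B where
  carrier := α.I g
  add_mem' {a b} ha hb := α.add_mem g a ha b hb
  zero_mem' := α.zero_mem g
  mul_mem' {a b} _ hb := α.mul_mem_left g a b hb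
  smul_mem' c a ha := α.smul_mem g c a ha
  star_mem' {a} ha := α.star_mem g a ha

/-- The map `α_g` as a star homomorphism on `A_{g⁻¹}`. -/
def CStarPartialAction.idealHom {G : Type*} [Group G] {B : Type*} [CStarAlgebra B]
    (α : CStarPartialAction G B) (g : G) : α.ideal g⁻¹ →⋆ₙₐ[ℂ] B where
  toFun a := α.θ g a
  map_smul' c a := α.θ_smul g c a a.2
  map_zero' := by simpa using α.θ_smul g 0 0 (α.zero_mem _)
  map_add' a b := α.θ_add g a a.2 b b.2
  map_mul' a b := α.θ_mul g a a.2 b b.2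
  map_star' a := α.θ_star g a a.2

theorem CStarPartialAction.sub_mem {G : Type*} [Group G] {B : Type*} [CStarAlgebra B]
    (α : CStarPartialAction G B) {g : G} {a b : B} (ha : a ∈ α.I g) (hb : b ∈ α.I g) :
    a - b ∈ α.I g :=
  _root_.sub_mem (show a ∈ α.ideal g from ha) (show b ∈ α.ideal g from hb)

theorem CStarPartialAction.θ_sub {G : Type*} [Group G] {B : Type*} [CStarAlgebra B]
    (α : CStarPartialAction G B) {g : G} {a b : B} (ha : a ∈ α.I g⁻¹) (hb : b ∈ α.I g⁻¹) :
    α.θ g (a - b) = α.θ g a - α.θ g b :=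
  map_sub (α.idealHom g) ⟨a, ha⟩ ⟨b, hb⟩

theorem CStarPartialAction.norm_θ_le {G : Type*} [Group G] {B : Type*} [CStarAlgebra B]
    (α : CStarPartialAction G B) {g : G} {a : B} (ha : a ∈ α.I g⁻¹) : ‖α.θ g a‖ ≤ ‖a‖ := by
  have : IsClosed (α.ideal g⁻¹ : Set B) := α.isClosed g⁻¹
  exact NonUnitalStarAlgHom.norm_apply_le (α.idealHom g) ⟨a, ha⟩

/-- Replacing `x` by `y` in an approximate equivariance relation costs at most `2 ‖x - y‖`. -/
theorem CStarPartialAction.norm_θ_mul_sub_le {G : Type*} [Group G] {B : Type*} [CStarAlgebra B]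
    (α : CStarPartialAction G B) {g : G} {x y p q : B} (hx : x ∈ α.I g⁻¹) (hy : y ∈ α.I g⁻¹)
    (hp : ‖p‖ ≤ 1) (hq : ‖q‖ ≤ 1) :
    ‖α.θ g (p * x) - q * α.θ g x‖ ≤ ‖α.θ g (p * y) - q * α.θ g y‖ + 2 * ‖x - y‖ := by
  have hd := α.sub_mem hx hy
  have hsplit : α.θ g (p * x) - q * α.θ g x = (α.θ g (p * y) - q * α.θ g y) +
      (α.θ g (p * (x - y)) - q * α.θ g (x - y)) := by
    rw [mul_sub, α.θ_sub (α.mul_mem_left _ p x hx) (α.mul_mem_left _ p y hy), α.θ_sub hx hy]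
    noncomm_ring
  have h₁ : ‖α.θ g (p * (x - y))‖ ≤ ‖x - y‖ :=
    (α.norm_θ_le (α.mul_mem_left _ p _ hd)).trans <|
      (norm_mul_le _ _).trans (mul_le_of_le_one_left (norm_nonneg _) hp)
  have h₂ : ‖q * α.θ g (x - y)‖ ≤ ‖x - y‖ :=
    (norm_mul_le _ _).trans <|
      (mul_le_of_le_one_left (norm_nonneg _) hq).trans (α.norm_θ_le hd)
  rw [hsplit]
  refine (norm_add_le _ _).trans ?_
  linarith [norm_sub_le (α.θ g (p * (x - y))) (q * α.θ g (x - y))]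

/-- Replacing `x` by `y` in a commutator with a contraction costs at most `2 ‖x - y‖`. -/
theorem norm_commutator_le_add {B : Type*} [NormedRing B] {p x y : B} (hp : ‖p‖ ≤ 1) :
    ‖p * x - x * p‖ ≤ ‖p * y - y * p‖ + 2 * ‖x - y‖ := by
  have hsplit : p * x - x * p = (p * y - y * p) + (p * (x - y) - (x - y) * p) := by
    noncomm_ring
  have h₁ : ‖p * (x - y)‖ ≤ ‖x - y‖ :=
    (norm_mul_le _ _).trans (mul_le_of_le_one_left (norm_nonneg _) hp)
  have h₂ : ‖(x - y) * p‖ ≤ ‖x - y‖ :=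
    (norm_mul_le _ _).trans (mul_le_of_le_one_right (norm_nonneg _) hp)
  rw [hsplit]
  refine (norm_add_le _ _).trans ?_
  linarith [norm_sub_le (p * (x - y)) ((x - y) * p)]

variable
    {G : Type*} [Group G] [Fintype G]
    {A : ℕ → Type*} [∀ i, CStarAlgebra (A i)]
    [∀ i, PartialOrder (A i)] [∀ i, StarOrderedRing (A i)]
    {L : Type*} [CStarAlgebra L] [PartialOrder L] [StarOrderedRing L]

/-- If `(L, μ)` is a concrete inductive limit of an inductive sequence of
partial dynamical systems on unital C*-algebras with unital connecting maps, `α` is the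
inductive limit partial action, and infinitely many of the `α⁽ⁱ⁾` have Rokhlin dimension at
most `k`, then `α` has Rokhlin dimension at most `k`
(hence `dim_Rok α ≤ liminf dim_Rok α⁽ⁱ⁾`). -/
theorem rokhlinDim_inductive_limit_partial_action
    (pa : ∀ i, CStarPartialAction G (A i))
    (φ : ∀ i, A i →⋆ₐ[ℂ] A (i + 1))
    (hφ : ∀ i, IsEquivariantMap (pa i) (pa (i + 1)) (φ i))
    (μ : ∀ i, A i →⋆ₐ[ℂ] L)
    (hμφ : ∀ i (a : A i), μ (i + 1) (φ i a) = μ i a)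
    (hdense : closure (⋃ i, Set.range (μ i)) = Set.univ)
    (hnorm : ∀ i (a : A i),
      Filter.Tendsto (fun j => ‖iterMap (fun i => ⇑(φ i)) i j a‖) Filter.atTop
        (nhds ‖μ i a‖))
    (α : CStarPartialAction G L)
    (hαI : ∀ g, α.I g = closure (⋃ i, μ i '' (pa i).I g))
    (hαθ : ∀ (g : G) (i : ℕ), ∀ a ∈ (pa i).I g⁻¹, α.θ g (μ i a) = μ i ((pa i).θ g a))
    (k : ℕ) (hk : ∀ N : ℕ, ∃ i, N ≤ i ∧ HasRokhlinDimLE (pa i) k) :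
    HasRokhlinDimLE α k := by
  classical
  have hpush : ∀ (g : G) (i N : ℕ), i ≤ N → ∀ a ∈ (pa i).I g,
      ∃ b ∈ (pa N).I g, μ N b = μ i a := by
    intro g i N hiN a ha
    induction N, hiN using Nat.le_induction with
    | base => exact ⟨a, ha, rfl⟩
    | succ n _ ih =>
      obtain ⟨b, hb, hba⟩ := ih
      exact ⟨φ n b, (hφ n).1 g ⟨b, hb, rfl⟩, (hμφ n b).trans hba⟩
  intro ε hε F
  have happrox : ∀ (x : L) (g : G), ∃ n, ∀ N, n ≤ N → x ∈ α.I g⁻¹ →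
      ∃ y ∈ (pa N).I g⁻¹, ‖x - μ N y‖ < ε / 4 := by
    intro x g
    by_cases hx : x ∈ α.I g⁻¹
    · obtain ⟨_, hz, hxz⟩ := Metric.mem_closure_iff.1 (hαI g⁻¹ ▸ hx) (ε / 4) (by positivity)
      obtain ⟨i, a, ha, rfl⟩ := Set.mem_iUnion.1 hz
      refine ⟨i, fun N hN _ => ?_⟩
      obtain ⟨b, hb, hba⟩ := hpush _ i N hN a ha
      exact ⟨b, hb, by rwa [hba, ← dist_eq_norm]⟩
    · exact ⟨0, fun _ _ h => absurd h hx⟩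
  choose n hn using happrox
  obtain ⟨i, hi, hdim⟩ := hk ((F ×ˢ Finset.univ).sup fun p : L × G => n p.1 p.2)
  have hlift : ∀ (x : L) (g : G), ∃ y : A i, x ∈ F → x ∈ α.I g⁻¹ →
      y ∈ (pa i).I g⁻¹ ∧ ‖x - μ i y‖ < ε / 4 := by
    intro x g
    by_cases hx : x ∈ F ∧ x ∈ α.I g⁻¹
    · have hle : n x g ≤ i :=
        (Finset.le_sup (f := fun p : L × G => n p.1 p.2) (b := (x, g)) (by simp [hx.1])).trans hi
      obtain ⟨y, hy⟩ := hn x g i hle hx.2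
      exact ⟨y, fun _ _ => hy⟩
    · exact ⟨0, fun h₁ h₂ => absurd ⟨h₁, h₂⟩ hx⟩
  choose y hy using hlift
  have hμ : ∀ a, ‖μ i a‖ ≤ ‖a‖ := fun a => NonUnitalStarAlgHom.norm_apply_le (μ i) a
  have hmem : ∀ g, ∀ a ∈ (pa i).I g, μ i a ∈ α.I g := fun g a ha =>
    hαI g ▸ subset_closure (Set.mem_iUnion.2 ⟨i, a, ha, rfl⟩)
  obtain ⟨f, hf, hequi, horth, hsum, hcomm⟩ := hdim (ε / 4) (by positivity)
    ((F ×ˢ Finset.univ).image fun p : L × G => y p.1 p.2)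
  have hyF : ∀ x ∈ F, ∀ g : G,
      y x g ∈ (F ×ˢ Finset.univ).image fun p : L × G => y p.1 p.2 := fun x hx g =>
    Finset.mem_image.2 ⟨(x, g), by simp [hx], rfl⟩
  have hfμ : ∀ j g, ‖μ i (f j g)‖ ≤ 1 := fun j g => (hμ _).trans (hf j g).2.2
  refine ⟨fun j g => μ i (f j g), fun j g =>
      ⟨hmem g _ (hf j g).1, map_nonneg (μ i) (hf j g).2.1, hfμ j g⟩,
    fun g h j x hx hxg => ?_, fun j g h hgh => ?_, ?_, fun j g x hx => ?_⟩
  · obtain ⟨hyI, hxy⟩ := hy x g hx hxg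
    have hstage := (hμ _).trans_lt (hequi g h j _ (hyF x hx g) hyI)
    rw [map_sub, map_mul, ← hαθ g i _ ((pa i).mul_mem_left _ _ _ hyI), ← hαθ g i _ hyI,
      map_mul] at hstage
    linarith [α.norm_θ_mul_sub_le hxg (hmem _ _ hyI) (hfμ j h) (hfμ j (g * h))]
  · rw [← map_mul]
    exact (hμ _).trans_lt ((horth j g h hgh).trans (by linarith))
  · have hstage := (hμ _).trans_lt hsum
    simp only [map_sub, map_sum, map_one] at hstage
    linarith
  · obtain ⟨-, hxy⟩ := hy x 1 hx (by simp [α.I_one])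
    have hstage := (hμ _).trans_lt (hcomm j g _ (hyF x hx 1))
    simp only [map_sub, map_mul] at hstage
    linarith [norm_commutator_le_add (x := x) (y := μ i (y x 1)) (hfμ j g)]
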